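/- arXiv:1801.06759 — 6 statements merged into one kernel-verified Lean document; each statement's English description precedes it below -/
import Mathlib

section
/- Let g be a positive integer, let Z be a finite set (of 'cycles'), let a : Z → (ZMod 2)^g (the 'annotation' map) be such that the image of a spans (ZMod 2)^g, and let σ : Z → ℝ be a size function with σ(z) ≥ 0 for all z. For u, v ∈ (ZMod 2)^g write ⟨u, v⟩ = ∑_{t=1}^{g} u_t·v_t. Suppose S_1, …, S_g ∈ (ZMod 2)^g and C_1, …, C_g ∈ Z satisfy: (1) S_1, …, S_g form a basis of (ZMod 2)^g; (2) ⟨S_i, a(C_j)⟩ = 0 whenever j < i; (3) for every i, ⟨S_i, a(C_i)⟩ = 1 and σ(C_i) ≤ σ(D) for every D ∈ Z with ⟨S_i, a(D)⟩ = 1. Then a(C_1), …, a(C_g) form a basis of (ZMod 2)^g, and for every B_1, …, B_g ∈ Z such that a(B_1), …, a(B_g) form a basis of (ZMod 2)^g, one has ∑_{i=1}^{g} σ(C_i) ≤ ∑_{i=1}^{g} σ(B_i). -/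
/-- A square matrix with nonzero determinant has a permutation all of whose entries are nonzero. -/
theorem Matrix.exists_perm_forall_ne_zero_of_det_ne_zero {n R : Type*} [Fintype n] [DecidableEq n]
    [CommRing R] {M : Matrix n n R} (hM : M.det ≠ 0) :
    ∃ π : Equiv.Perm n, ∀ i, M (π i) i ≠ 0 := by
  by_contra! h
  refine hM ?_
  rw [Matrix.det_apply]
  refine Finset.sum_eq_zero fun π _ => ?_
  obtain ⟨i, hi⟩ := h π
  have hprod : ∏ j, M (π j) j = 0 := Finset.prod_eq_zero (Finset.mem_univ i) hi
  simp only [hprod, smul_zero]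

/-- Theorem 1 of the paper: the cycles chosen by maintaining properties (1), (2), (3)
form a minimal homology basis (their annotations form a basis of `(ZMod 2)^g`, and
their total size is at most that of any other homology basis). -/
theorem stmt_2 (g : ℕ) (hg : 0 < g) (Z : Type*) [Finite Z]
    (a : Z → (Fin g → ZMod 2))
    (ha_span : Submodule.span (ZMod 2) (Set.range a) = ⊤)
    (σ : Z → ℝ) (hσ : ∀ z, 0 ≤ σ z)
    (S : Fin g → (Fin g → ZMod 2)) (C : Fin g → Z)
    (hS_indep : LinearIndependent (ZMod 2) S)
    (hS_span : Submodule.span (ZMod 2) (Set.range S) = ⊤)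
    (horth : ∀ i j : Fin g, j < i → ∑ t, S i t * a (C j) t = 0)
    (hdiag : ∀ i : Fin g, ∑ t, S i t * a (C i) t = 1)
    (hmin : ∀ i : Fin g, ∀ D : Z, (∑ t, S i t * a D t) = 1 → σ (C i) ≤ σ D) :
    (LinearIndependent (ZMod 2) (fun i => a (C i)) ∧
      Submodule.span (ZMod 2) (Set.range (fun i => a (C i))) = ⊤) ∧
    ∀ B : Fin g → Z,
      (LinearIndependent (ZMod 2) (fun i => a (B i)) ∧
        Submodule.span (ZMod 2) (Set.range (fun i => a (B i))) = ⊤) →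
      ∑ i, σ (C i) ≤ ∑ i, σ (B i) := by
  have mul_apply (D : Fin g → Z) (i j : Fin g) :
      (Matrix.of S * (Matrix.of fun k => a (D k)).transpose) i j = ∑ t, S i t * a (D j) t := rfl
  constructor
  · have hdet : (Matrix.of S * (Matrix.of fun k => a (C k)).transpose).det = 1 := by
      have htri : (Matrix.of S * (Matrix.of fun k => a (C k)).transpose).IsUpperTriangular :=
        fun i j hij => horth i j hij
      rw [Matrix.det_of_isUpperTriangular htri]
      exact Finset.prod_eq_one fun i _ => hdiag i
    have hli : LinearIndependent (ZMod 2) fun i => a (C i) := by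
      refine Matrix.linearIndependent_rows_iff_isUnit (A := Matrix.of fun k => a (C k)) |>.2 ?_
      rw [Matrix.isUnit_iff_isUnit_det, ← Matrix.det_transpose]
      rw [Matrix.det_mul] at hdet
      exact IsUnit.of_mul_eq_one_right _ hdet
    exact ⟨hli, hli.span_eq_top_of_card_eq_finrank' (by simp)⟩
  · rintro B ⟨hB, -⟩
    have hSu : IsUnit (Matrix.of S) := Matrix.linearIndependent_rows_iff_isUnit.1 hS_indep
    have hBu : IsUnit (Matrix.of fun k => a (B k)) :=
      Matrix.linearIndependent_rows_iff_isUnit.1 hB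
    rw [Matrix.isUnit_iff_isUnit_det] at hSu hBu
    have hdet : (Matrix.of S * (Matrix.of fun k => a (B k)).transpose).det ≠ 0 := by
      rw [Matrix.det_mul, Matrix.det_transpose]
      exact (hSu.mul hBu).ne_zero
    obtain ⟨π, hπ⟩ := Matrix.exists_perm_forall_ne_zero_of_det_ne_zero hdet
    rw [← Equiv.sum_comp π fun i => σ (C i)]
    refine Finset.sum_le_sum fun i _ => hmin (π i) (B i) ?_
    have hne := hπ i
    rw [mul_apply] at hne
    exact Fin.eq_one_of_ne_zero _ hne
end

section
/- Let V and H be finite-dimensional vector spaces over ZMod 2, let q : V → H be a surjective linear map, let g = dim H, and let σ : V → ℝ be a size function with σ(v) ≥ 0 for all v. Let C*_1, …, C*_g ∈ V be such that q(C*_1), …, q(C*_g) form a basis of H and σ(C*_1) ≤ σ(C*_2) ≤ ⋯ ≤ σ(C*_g). Let G ⊆ V, and suppose that for each i ∈ {1, …, g} there is a finite subset Γ_i ⊆ G such that C*_i = ∑_{γ ∈ Γ_i} γ and σ(γ) ≤ 2·σ(C*_i) for every γ ∈ Γ_i. Then there exist A_1, …, A_g ∈ G such that q(A_1), …, q(A_g)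 form a basis of H and σ(A_i) ≤ 2·σ(C*_i) for every i = 1, …, g. -/
/-- If `v 0, …, v (n - 1)` are linearly independent and each `v i` lies in the span of the `i`-th
set of an increasing family, then the family has a linearly independent transversal. -/
theorem exists_linearIndependent_transversal {K E : Type*} [Field K] [AddCommGroup E] [Module K E]
    {n : ℕ} {v : Fin n → E} (hv : LinearIndependent K v) {T : Fin n → Set E} (hT : Monotone T)
    (hvT : ∀ i, v i ∈ Submodule.span K (T i)) :
    ∃ w : Fin n → E, (∀ i, w i ∈ T i) ∧ LinearIndependent K w := by
  induction n with
  | zero => exact ⟨v, fun i => i.elim0, hv⟩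
  | succ n ih =>
    obtain ⟨w, hwT, hw⟩ := ih (hv.comp Fin.castSucc (Fin.castSucc_injective n))
      (hT.comp Fin.strictMono_castSucc.monotone) fun i => hvT i.castSucc
    obtain ⟨x, hxT, hx⟩ : ∃ x ∈ T (Fin.last n), x ∉ Submodule.span K (Set.range w) := by
      by_contra! h
      have hle : Submodule.span K (Set.range v) ≤ Submodule.span K (Set.range w) := by
        rw [Submodule.span_le]
        rintro _ ⟨i, rfl⟩
        exact Submodule.span_le.2 (fun y hy => h y (hT (Fin.le_last i) hy)) (hvT i)
      have : FiniteDimensional K (Submodule.span K (Set.range w)) :=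
        FiniteDimensional.span_of_finite K (Set.finite_range w)
      have hrank := Submodule.finrank_mono hle
      rw [finrank_span_eq_card hv, finrank_span_eq_card hw, Fintype.card_fin,
        Fintype.card_fin] at hrank
      omega
    refine ⟨Fin.snoc w x, fun i => ?_, linearIndependent_finSnoc.2 ⟨hw, hx⟩⟩
    induction i using Fin.lastCases with
    | last => simpa using hxT
    | cast i => simpa using hwT i

/-- Lemma 1 of the paper: if each member `C* i` of a homology basis (sorted by size)
decomposes as a sum of cycles from `G` each of size at most `2 σ(C* i)`, then `G`
contains `g` cycles `A i` forming a homology basis with `σ(A i) ≤ 2 σ(C* i)`. -/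
theorem stmt_4 (V H : Type*)
    [AddCommGroup V] [Module (ZMod 2) V] [FiniteDimensional (ZMod 2) V]
    [AddCommGroup H] [Module (ZMod 2) H] [FiniteDimensional (ZMod 2) H]
    (q : V →ₗ[ZMod 2] H) (hq : Function.Surjective q)
    (g : ℕ) (hg : g = Module.finrank (ZMod 2) H)
    (σ : V → ℝ) (hσ : ∀ v, 0 ≤ σ v)
    (Cstar : Fin g → V)
    (hC_indep : LinearIndependent (ZMod 2) (fun i => q (Cstar i)))
    (hC_span : Submodule.span (ZMod 2) (Set.range (fun i => q (Cstar i))) = ⊤)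
    (hC_sorted : Monotone (fun i => σ (Cstar i)))
    (G : Set V) (Γ : Fin g → Finset V)
    (hΓ_sub : ∀ i, (Γ i : Set V) ⊆ G)
    (hΓ_sum : ∀ i, Cstar i = ∑ γ ∈ Γ i, γ)
    (hΓ_size : ∀ i, ∀ γ ∈ Γ i, σ γ ≤ 2 * σ (Cstar i)) :
    ∃ A : Fin g → V, (∀ i, A i ∈ G) ∧
      LinearIndependent (ZMod 2) (fun i => q (A i)) ∧
      Submodule.span (ZMod 2) (Set.range (fun i => q (A i))) = ⊤ ∧
      ∀ i, σ (A i) ≤ 2 * σ (Cstar i) := by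
  have hT : Monotone fun i => q '' {v | v ∈ G ∧ σ v ≤ 2 * σ (Cstar i)} := fun i j hij =>
    Set.image_mono fun v hv => ⟨hv.1, hv.2.trans (by have := hC_sorted hij; dsimp at this; linarith)⟩
  obtain ⟨w, hwT, hw⟩ := exists_linearIndependent_transversal hC_indep hT fun i => by
    have hsum : q (Cstar i) = ∑ γ ∈ Γ i, q γ := by rw [hΓ_sum i, map_sum]
    rw [hsum]
    exact Submodule.sum_mem _ fun γ hγ =>
      Submodule.subset_span ⟨γ, ⟨hΓ_sub i hγ, hΓ_size i γ hγ⟩, rfl⟩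
  choose A hA hAw using hwT
  obtain rfl : (fun i => q (A i)) = w := funext hAw
  exact ⟨A, fun i => (hA i).1, hw,
    hw.span_eq_top_of_card_eq_finrank' (by rw [Fintype.card_fin, hg]), fun i => (hA i).2⟩
end

section
/- Let V and H be finite-dimensional vector spaces over ZMod 2, let q : V → H be a surjective linear map, let g = dim H, and let σ : V → ℝ be a size function with σ(v) ≥ 0 for all v. Call a tuple (B_1, …, B_g) of elements of V a homology basis if q(B_1), …, q(B_g) form a basis of H. Suppose (C*_1, …, C*_g) is a minimal homology basis, i.e. a homology basis such that ∑_{i=1}^{g} σ(C*_i) ≤ ∑_{i=1}^{g} σ(B_i) for every homology basis (B_1, …, B_g). Then for every homology basis (B_1, …, B_g), if ℓ*_1 ≤ ⋯ ≤ ℓ*_g denotes the sequence σ(C*_1), …, σ(C*_g) sorted in nondecreasing order and ℓ_1 ≤ ⋯ ≤ ℓ_g denotes σ(B_1), …, σ(B_g) sorted in nondecreasing order, then ℓ*_i ≤ ℓ_i for every i = 1, …, g. -/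
/-- A vector with nonzero coordinate `k` in a basis can replace the `k`-th basis vector. -/
theorem linearIndependent_update_of_repr_ne_zero {K M ι : Type*} [Field K] [AddCommGroup M]
    [Module K M] [DecidableEq ι] (b : Module.Basis ι K M) {k : ι} {v : M}
    (h : b.repr v k ≠ 0) : LinearIndependent K (Function.update b k v) :=
  b.linearIndependent.update k v ⟨1, one_mem _, b.repr v, mem_nonZeroDivisors_of_ne_zero h,
    by rw [one_smul, b.linearCombination_repr]⟩

/-- If every vector of a linearly independent finite family `v` has all its nonzero coordinates,
in a basis `b`, at places where `f` is at most its own weight, then `v` has at most as many vectors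
of weight at most `t` as `b`. -/
theorem card_filter_le_card_filter_of_repr_ne_zero {K M ι κ : Type*} [Field K] [AddCommGroup M]
    [Module K M] [Fintype ι] [Fintype κ] (b : Module.Basis ι K M) {v : κ → M}
    (hv : LinearIndependent K v) (f : ι → ℝ) (w : κ → ℝ)
    (h : ∀ j k, b.repr (v j) k ≠ 0 → f k ≤ w j) (t : ℝ) :
    (Finset.univ.filter fun j => w j ≤ t).card ≤ (Finset.univ.filter fun k => f k ≤ t).card := by
  classical
  have hspan : Set.range (fun j : {j // w j ≤ t} => v j) ≤
      Submodule.span K (b '' {k | f k ≤ t}) := by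
    rintro _ ⟨⟨j, hj⟩, rfl⟩
    refine b.mem_span_image.2 fun k hk => ?_
    exact (h j k (by simpa using hk)).trans hj
  have hcard := linearIndependent_le_span_aux' _ (hv.comp _ Subtype.val_injective) _ hspan
  rw [Set.card_image_of_injective _ b.injective] at hcard
  simpa [Fintype.card_subtype] using hcard

/-- Sorted tuples are ordered pointwise as soon as their sublevel counts are. -/
theorem apply_sort_le_apply_sort_of_card_filter_le {n : ℕ} {α : Type*} [LinearOrder α]
    (f g : Fin n → α)
    (h : ∀ t, (Finset.univ.filter fun j => g j ≤ t).card ≤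
      (Finset.univ.filter fun j => f j ≤ t).card) (i : Fin n) :
    f (Tuple.sort f i) ≤ g (Tuple.sort g i) := by
  have hperm (u : Fin n → α) (t : α) :
      (Finset.univ.filter fun j => (u ∘ Tuple.sort u) j ≤ t).card =
        (Finset.univ.filter fun j => u j ≤ t).card := by
    refine Finset.card_equiv (Tuple.sort u) fun j => ?_
    simp
  refine (Tuple.lt_card_le_iff_apply_le_of_monotone (Tuple.monotone_sort f)).1 ?_
  rw [hperm]
  refine lt_of_lt_of_le ?_ (h _)
  rw [← hperm]
  exact (Tuple.lt_card_le_iff_apply_le_of_monotone (Tuple.monotone_sort g)).2 le_rfl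

/-- The sorted size sequence of a minimal (total-size) homology basis is dominated
pointwise by the sorted size sequence of any homology basis. -/
theorem stmt_5 (V H : Type*)
    [AddCommGroup V] [Module (ZMod 2) V] [FiniteDimensional (ZMod 2) V]
    [AddCommGroup H] [Module (ZMod 2) H] [FiniteDimensional (ZMod 2) H]
    (q : V →ₗ[ZMod 2] H) (hq : Function.Surjective q)
    (g : ℕ) (hg : g = Module.finrank (ZMod 2) H)
    (σ : V → ℝ) (hσ : ∀ v, 0 ≤ σ v)
    (Cstar : Fin g → V)
    (hC_basis : LinearIndependent (ZMod 2) (fun i => q (Cstar i)) ∧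
      Submodule.span (ZMod 2) (Set.range (fun i => q (Cstar i))) = ⊤)
    (hC_min : ∀ B : Fin g → V,
      (LinearIndependent (ZMod 2) (fun i => q (B i)) ∧
        Submodule.span (ZMod 2) (Set.range (fun i => q (B i))) = ⊤) →
      ∑ i, σ (Cstar i) ≤ ∑ i, σ (B i)) :
    ∀ B : Fin g → V,
      (LinearIndependent (ZMod 2) (fun i => q (B i)) ∧
        Submodule.span (ZMod 2) (Set.range (fun i => q (B i))) = ⊤) →
      ∀ i : Fin g,
        (fun j => σ (Cstar j)) (Tuple.sort (fun j => σ (Cstar j)) i) ≤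
          (fun j => σ (B j)) (Tuple.sort (fun j => σ (B j)) i) := by
  intro B hB i
  let b := Module.Basis.mk hC_basis.1 hC_basis.2.ge
  have hb : ⇑b = fun i => q (Cstar i) := Module.Basis.coe_mk _ _
  have hexchange (v : V) (k : Fin g) (hk : b.repr (q v) k ≠ 0) : σ (Cstar k) ≤ σ v := by
    have hq_update : (fun i => q (Function.update Cstar k v i)) = Function.update b k (q v) := by
      rw [hb]
      exact Function.comp_update q Cstar k v
    have hli := linearIndependent_update_of_repr_ne_zero b hk
    have hle := hC_min (Function.update Cstar k v) (by
      rw [hq_update]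
      exact ⟨hli, hli.span_eq_top_of_card_eq_finrank' (by simpa using hg)⟩)
    have hsum : ∑ i, σ (Function.update Cstar k v i) =
        σ v + ∑ i ∈ Finset.univ \ {k}, σ (Cstar i) := by
      rw [← Finset.sum_update_of_mem (Finset.mem_univ k)]
      exact Finset.sum_congr rfl fun i _ => congrFun (Function.comp_update σ Cstar k v) i
    rw [hsum, Finset.sum_eq_add_sum_sdiff_singleton_of_mem (Finset.mem_univ k)] at hle
    linarith
  exact apply_sort_le_apply_sort_of_card_filter_le _ _
    (card_filter_le_card_filter_of_repr_ne_zero b hB.1 _ _ fun j k => hexchange (B j) k) i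
end

section
/- Let V and H be finite-dimensional vector spaces over ZMod 2, let q : V → H be a surjective linear map, let g = dim H, and let σ : V → ℝ be a size function with σ(v) ≥ 0 for all v. Call a tuple (B_1, …, B_g) of elements of V a homology basis if q(B_1), …, q(B_g) form a basis of H. Suppose (C*_1, …, C*_g) is a minimal homology basis, i.e. ∑_i σ(C*_i) ≤ ∑_i σ(B_i) for every homology basis (B_1, …, B_g), with σ(C*_1) ≤ σ(C*_2) ≤ ⋯ ≤ σ(C*_g); write ℓ*_i = σ(C*_i). Let G ⊆ V, and suppose that for each i there is a finite subset Γ_i ⊆ G such that C*_i = ∑_{γ ∈ Γ_i} γ and σ(γ) ≤ 2·ℓ*_i for every γ ∈ Γ_i. Then there exists a homology basis (B_1, …, B_g) with every B_i ∈ G such that, letting ℓ_1 ≤ ⋯ ≤ ℓ_g be the sequence σ(B_1), …, σ(B_g) sorted in nondecreasing order, one has ℓ*_i ≤ ℓ_i ≤ 2·ℓ*_i for every i = 1, …, g. -/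
open Module

theorem LinearIndependent.exists_notMem_of_finrank_lt_card {K W ι : Type*} [Field K]
    [AddCommGroup W] [Module K W] {x : ι → W} (hx : LinearIndependent K x) (s : Finset ι)
    (U : Submodule K W) [FiniteDimensional K U] (h : finrank K U < s.card) :
    ∃ j ∈ s, x j ∉ U := by
  by_contra! hU
  have hs : LinearIndependent K (fun j : s => x j) := hx.comp _ Subtype.val_injective
  have hle : Submodule.span K (Set.range fun j : s => x j) ≤ U := by
    rw [Submodule.span_le]
    rintro _ ⟨j, rfl⟩
    exact hU j j.2
  have := Submodule.finrank_mono hle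
  rw [finrank_span_eq_card hs, Fintype.card_coe] at this
  omega

/-- A vector outside the span of a subfamily of a spanning independent family can be exchanged
for a member of the family outside that subfamily. -/
theorem LinearIndependent.exists_update_of_notMem_span {K W ι : Type*} [Field K]
    [AddCommGroup W] [Module K W] [DecidableEq ι] {x : ι → W} (hx : LinearIndependent K x)
    (hspan : Submodule.span K (Set.range x) = ⊤) {t : Set ι} {w : W}
    (hw : w ∉ Submodule.span K (x '' t)) :
    ∃ m ∉ t, LinearIndependent K (Function.update x m w) := by
  obtain ⟨l, hl⟩ := (Finsupp.mem_span_range_iff_exists_finsupp (R := K) (v := x) (x := w)).1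
    (hspan ▸ Submodule.mem_top)
  by_contra! hm
  refine hw ((Finsupp.mem_span_image_iff_linearCombination K).2 ⟨l, fun m hmem => ?_, hl⟩)
  by_contra hmt
  refine hm m hmt (hx.update m w ⟨1, one_mem _, l, ?_, ?_⟩)
  · exact mem_nonZeroDivisors_of_ne_zero (Finsupp.mem_support_iff.1 hmem)
  · rw [one_smul, ← hl, Finsupp.linearCombination_apply]

/-- A pointwise monotone upper bound of a tuple bounds the sorted tuple. -/
theorem Tuple.apply_sort_le_of_le {α : Type*} [LinearOrder α] {n : ℕ} {f h : Fin n → α}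
    (hh : Monotone h) (hfh : ∀ j, f j ≤ h j) (i : Fin n) : f (Tuple.sort f i) ≤ h i := by
  obtain ⟨j, hij, hj⟩ : ∃ j, i ≤ j ∧ Tuple.sort f j ≤ i := by
    by_contra! hlt
    have hcard := Finset.card_le_card_of_injOn (s := Finset.Ici i) (t := Finset.Ioi i)
      (Tuple.sort f) (fun j hj => by simpa using hlt j (by simpa using hj))
      (Tuple.sort f).injective.injOn
    simp only [Fin.card_Ici, Fin.card_Ioi] at hcard
    omega
  exact (Tuple.monotone_sort f hij).trans ((hfh _).trans (hh hj))

/-- If each vector of an independent family is a sum of elements of `G`, none heavier than the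
corresponding bound, then greedily chosen elements of `G` are independent and satisfy the same
bounds. -/
theorem exists_linearIndependent_of_sum_decomposition {K V H : Type*} [Field K]
    [AddCommGroup V] [Module K V] [AddCommGroup H] [Module K H] (q : V →ₗ[K] H) {g : ℕ}
    {C : Fin g → V} (hC : LinearIndependent K fun i => q (C i)) {σ : V → ℝ} {b : Fin g → ℝ}
    (hb : Monotone b) {G : Set V} (Γ : Fin g → Finset V) (hΓ_sub : ∀ i, (Γ i : Set V) ⊆ G)
    (hΓ_sum : ∀ i, C i = ∑ γ ∈ Γ i, γ) (hΓ_size : ∀ i, ∀ γ ∈ Γ i, σ γ ≤ b i) :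
    ∃ B : Fin g → V, (∀ i, B i ∈ G) ∧ LinearIndependent K (fun i => q (B i)) ∧
      ∀ i, σ (B i) ≤ b i := by
  suffices ∀ k (hk : k ≤ g), ∃ B : Fin k → V, (∀ i, B i ∈ G) ∧
      LinearIndependent K (fun i => q (B i)) ∧ ∀ i, σ (B i) ≤ b (i.castLE hk) from
    this g le_rfl
  intro k
  induction k with
  | zero => exact fun _ => ⟨Fin.elim0, fun i => i.elim0, linearIndependent_empty_type,
      fun i => i.elim0⟩
  | succ k ih =>
    intro hk
    obtain ⟨B, hBG, hB, hBb⟩ := ih (by omega)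
    have : FiniteDimensional K (Submodule.span K (Set.range fun i => q (B i))) :=
      FiniteDimensional.span_of_finite K (Set.finite_range _)
    obtain ⟨j, hj, hjU⟩ := hC.exists_notMem_of_finrank_lt_card (Finset.Iic ⟨k, hk⟩)
      (Submodule.span K (Set.range fun i => q (B i)))
      (by rw [finrank_span_eq_card hB]; simp)
    obtain ⟨γ, hγ, hγU⟩ : ∃ γ ∈ Γ j, q γ ∉ Submodule.span K (Set.range fun i => q (B i)) := by
      by_contra! hmem
      rw [hΓ_sum, map_sum] at hjU
      exact hjU (Submodule.sum_mem _ hmem)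
    refine ⟨Fin.snoc B γ, fun i => ?_, ?_, fun i => ?_⟩
    · refine Fin.lastCases ?_ (fun i => ?_) i
      · simpa using hΓ_sub j hγ
      · simpa using hBG i
    · convert linearIndependent_finSnoc.2 ⟨hB, hγU⟩ using 1
      exact Fin.comp_snoc q B γ
    · refine Fin.lastCases ?_ (fun i => ?_) i
      · rw [Fin.snoc_last]
        exact (hΓ_size j γ hγ).trans (hb (Finset.mem_Iic.1 hj))
      · simpa using hBb i

/-- The sorted sizes of an independent family dominate those of a spanning independent family of
minimal total size. -/
theorem apply_le_apply_sort_of_minimal {K V H : Type*} [Field K]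
    [AddCommGroup V] [Module K V] [AddCommGroup H] [Module K H] (q : V →ₗ[K] H) {g : ℕ}
    {C : Fin g → V} (hC : LinearIndependent K fun i => q (C i))
    (hC_span : Submodule.span K (Set.range fun i => q (C i)) = ⊤) {σ : V → ℝ}
    (hC_min : ∀ B : Fin g → V, LinearIndependent K (fun i => q (B i)) →
      ∑ i, σ (C i) ≤ ∑ i, σ (B i))
    (hC_sorted : Monotone fun i => σ (C i))
    {B : Fin g → V} (hB : LinearIndependent K fun i => q (B i)) (i : Fin g) :
    σ (C i) ≤ σ (B (Tuple.sort (fun j => σ (B j)) i)) := by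
  set p := Tuple.sort (fun j => σ (B j))
  have : FiniteDimensional K (Submodule.span K ((fun j => q (C j)) '' Set.Iio i)) :=
    FiniteDimensional.span_of_finite K (Set.toFinite _)
  obtain ⟨j, hj, hjU⟩ := (hB.comp p p.injective).exists_notMem_of_finrank_lt_card
    (Finset.Iic i) (Submodule.span K ((fun j => q (C j)) '' Set.Iio i)) (by
      have hcard := finrank_span_eq_card
        (hC.comp (Subtype.val : Set.Iio i → Fin g) Subtype.val_injective)
      rw [Set.range_comp, Subtype.range_coe] at hcard
      rw [hcard, Fintype.card_of_subtype (Finset.Iio i) (by simp)]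
      simp)
  obtain ⟨m, hm, hind⟩ := hC.exists_update_of_notMem_span hC_span hjU
  have hsum := hC_min (Function.update C m (B (p j))) (by
    convert hind using 1
    exact Function.comp_update q C m (B (p j)))
  have hupd : (fun k => σ (Function.update C m (B (p j)) k)) =
      Function.update (fun k => σ (C k)) m (σ (B (p j))) := Function.comp_update σ C m (B (p j))
  rw [hupd, Finset.sum_update_of_mem (Finset.mem_univ m),
    ← Finset.add_sum_erase _ _ (Finset.mem_univ m), Finset.sdiff_singleton_eq_erase] at hsum
  calc σ (C i) ≤ σ (C m) := hC_sorted (by simpa using hm)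
    _ ≤ σ (B (p j)) := le_of_add_le_add_right hsum
    _ ≤ σ (B (p i)) := Tuple.monotone_sort (fun j => σ (B j)) (Finset.mem_Iic.1 hj)


/-- Section 4 of the paper: a candidate set `G` satisfying the decomposition property of
Proposition 3 with respect to a minimal homology basis `C*` (sorted by size) contains a
2-approximate minimal homology basis. -/
theorem stmt_7 (V H : Type*)
    [AddCommGroup V] [Module (ZMod 2) V] [FiniteDimensional (ZMod 2) V]
    [AddCommGroup H] [Module (ZMod 2) H] [FiniteDimensional (ZMod 2) H]
    (q : V →ₗ[ZMod 2] H) (hq : Function.Surjective q)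
    (g : ℕ) (hg : g = Module.finrank (ZMod 2) H)
    (σ : V → ℝ) (hσ : ∀ v, 0 ≤ σ v)
    (Cstar : Fin g → V)
    (hC_basis : LinearIndependent (ZMod 2) (fun i => q (Cstar i)) ∧
      Submodule.span (ZMod 2) (Set.range (fun i => q (Cstar i))) = ⊤)
    (hC_min : ∀ B : Fin g → V,
      (LinearIndependent (ZMod 2) (fun i => q (B i)) ∧
        Submodule.span (ZMod 2) (Set.range (fun i => q (B i))) = ⊤) →
      ∑ i, σ (Cstar i) ≤ ∑ i, σ (B i))
    (hC_sorted : Monotone (fun i => σ (Cstar i)))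
    (G : Set V) (Γ : Fin g → Finset V)
    (hΓ_sub : ∀ i, (Γ i : Set V) ⊆ G)
    (hΓ_sum : ∀ i, Cstar i = ∑ γ ∈ Γ i, γ)
    (hΓ_size : ∀ i, ∀ γ ∈ Γ i, σ γ ≤ 2 * σ (Cstar i)) :
    ∃ B : Fin g → V, (∀ i, B i ∈ G) ∧
      (LinearIndependent (ZMod 2) (fun i => q (B i)) ∧
        Submodule.span (ZMod 2) (Set.range (fun i => q (B i))) = ⊤) ∧
      ∀ i : Fin g,
        σ (Cstar i) ≤ (fun j => σ (B j)) (Tuple.sort (fun j => σ (B j)) i) ∧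
        (fun j => σ (B j)) (Tuple.sort (fun j => σ (B j)) i) ≤ 2 * σ (Cstar i) := by
  have hspan : ∀ B : Fin g → V, LinearIndependent (ZMod 2) (fun i => q (B i)) →
      Submodule.span (ZMod 2) (Set.range (fun i => q (B i))) = ⊤ :=
    fun B hB => hB.span_eq_top_of_card_eq_finrank' (by simpa using hg)
  have hbound : Monotone fun i => 2 * σ (Cstar i) :=
    fun i j hij => mul_le_mul_of_nonneg_left (hC_sorted hij) zero_le_two
  obtain ⟨B, hBG, hB, hBb⟩ := exists_linearIndependent_of_sum_decomposition q hC_basis.1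
    hbound Γ hΓ_sub hΓ_sum hΓ_size
  exact ⟨B, hBG, ⟨hB, hspan B hB⟩, fun i =>
    ⟨apply_le_apply_sort_of_minimal q hC_basis.1 hC_basis.2
      (fun B' hB' => hC_min B' ⟨hB', hspan B' hB'⟩) hC_sorted hB i,
    Tuple.apply_sort_le_of_le hbound hBb i⟩⟩
end

section
/- Let G be a simple graph on a finite vertex set V, and let d : V × V → ℝ be a path-dominated distance function with respect to G, i.e.: (i) d(x, y) ≥ 0 and d(x, x) = 0 for all x, y ∈ V; (ii) for any two vertices x, y ∈ V there exists a walk π* in G from x to y such that d(x, y) = max_{u ∈ support(π*)} d(x, u). Then for any two vertices x, y ∈ V there exists a walk π in G from x to y whose vertex sequence u_0 = x, u_1, …, u_k = y satisfies d(x, u_i) = max_{j ≤ i} d(x, u_j) for every i ∈ {1, …, k} (equivalently, the sequence d(x, u_0), d(x, u_1), …, d(x, u_k) is nondecreasing). -/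
namespace SimpleGraph.Walk

variable {V : Type*} {G : SimpleGraph V} {f : V → ℝ}

/-- A walk along which `f` is monotone can be extended by an edge along which `f` does not
decrease. -/
theorem exists_isChain_support_of_adj {x a b : V}
    (h : ∃ p : G.Walk x a, p.support.IsChain (fun u v => f u ≤ f v))
    (hab : G.Adj a b) (hf : f a ≤ f b) :
    ∃ p : G.Walk x b, p.support.IsChain (fun u v => f u ≤ f v) := by
  obtain ⟨p, hp⟩ := h
  refine ⟨p.concat hab, ?_⟩
  rw [support_concat, List.isChain_append]
  refine ⟨hp, .singleton b, fun u hu v hv => ?_⟩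
  rw [List.getLast?_eq_some_getLast p.support_ne_nil, getLast_support] at hu
  simp_all

/-- If every vertex below level `r` is reached from `x` by a walk along which `f` is monotone,
then so is the end of any walk that stays within level `r` and starts at such a vertex. -/
theorem exists_isChain_support_of_forall_le {x a b : V} {r : ℝ}
    (hr : ∀ z, f z < r → ∃ p : G.Walk x z, p.support.IsChain (fun u v => f u ≤ f v))
    (q : G.Walk a b) (hq : ∀ u ∈ q.support, f u ≤ r)
    (ha : ∃ p : G.Walk x a, p.support.IsChain (fun u v => f u ≤ f v)) :
    ∃ p : G.Walk x b, p.support.IsChain (fun u v => f u ≤ f v) := by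
  induction q with
  | nil => exact ha
  | @cons a c b hac q ih =>
    refine ih (fun u hu => hq u (by simp [hu])) ?_
    rcases lt_or_ge (f c) r with hc | hc
    · exact hr c hc
    · exact exists_isChain_support_of_adj ha hac ((hq a (by simp)).trans hc)

end SimpleGraph.Walk

/-- Claim 4 of the paper: if `d` is a path-dominated distance function w.r.t. a finite
simple graph `G`, then between any two vertices there exists a d-dominated shortest path,
i.e. a walk along which the distances from the source are nondecreasing. -/
theorem stmt_8 {V : Type*} [Fintype V] (G : SimpleGraph V) (d : V → V → ℝ)
    (h_nonneg : ∀ x y : V, 0 ≤ d x y) (h_refl : ∀ x : V, d x x = 0)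
    (h_dom : ∀ x y : V, ∃ p : G.Walk x y,
      IsGreatest {r : ℝ | ∃ u ∈ p.support, r = d x u} (d x y)) :
    ∀ x y : V, ∃ p : G.Walk x y,
      List.Chain' (fun u v => d x u ≤ d x v) p.support := by
  intro x y
  have wf : WellFounded (fun a b : V => d x a < d x b) :=
    haveI : IsTrans V (fun a b => d x a < d x b) := ⟨fun _ _ _ => lt_trans⟩
    haveI : Std.Irrefl (fun a b : V => d x a < d x b) := ⟨fun _ => lt_irrefl _⟩
    Finite.wellFounded_of_trans_of_irrefl _
  induction y using wf.induction with
  | _ y ih =>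
    obtain ⟨q, -, hq⟩ := h_dom x y
    exact q.exists_isChain_support_of_forall_le ih (fun u hu => hq ⟨u, hu, rfl⟩)
      ⟨.nil, .singleton x⟩
end

section
/- Let G be a connected simple graph on a finite vertex set V, let (Z, d_Z) be a metric space, and let F : V → Z. For x, y ∈ V define the F-induced distance d_F(x, y) as the minimum, over all walks π in G from x to y, of max_{u ∈ support(π)} d_Z(F(x), F(u)) (this minimum exists since V is finite and G is connected). Then d_F is a path-dominated distance function with respect to G, namely: (i) d_F(x, y) ≥ 0 and d_F(x, x) = 0 for all x, y ∈ V; (ii) for any two vertices x, y ∈ V there exists a walk π* in G from x to y such that d_F(x, y) = max_{u ∈ support(π*)} d_F(x, u). -/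
/-- A real-valued function attains its maximum over the support of a walk. -/
theorem SimpleGraph.Walk.exists_isGreatest_support {V : Type*} {G : SimpleGraph V} {x y : V}
    (p : G.Walk x y) (f : V → ℝ) :
    ∃ r, IsGreatest {s : ℝ | ∃ u ∈ p.support, s = f u} r := by
  obtain ⟨u, hu, hmax⟩ := Set.exists_max_image {u | u ∈ p.support} f
    p.support.finite_toSet ⟨x, p.start_mem_support⟩
  refine ⟨f u, ⟨u, hu, rfl⟩, ?_⟩
  rintro _ ⟨v, hv, rfl⟩
  exact hmax v hv

/-- Claim 5 of the paper: given a map `F` from the vertices of a connected finite simple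
graph `G` to a metric space `Z`, the `F`-induced distance `dF x y` — the minimum over all
walks `p` from `x` to `y` of `max_{u ∈ support p} d_Z(F x, F u)` — is a path-dominated
distance function with respect to `G`. -/
theorem stmt_9 {V : Type*} [Fintype V] (G : SimpleGraph V) (hG : G.Connected)
    {Z : Type*} [MetricSpace Z] (F : V → Z) (dF : V → V → ℝ)
    (hdF : ∀ x y : V, IsLeast
      {r : ℝ | ∃ p : G.Walk x y,
        IsGreatest {s : ℝ | ∃ u ∈ p.support, s = dist (F x) (F u)} r}
      (dF x y)) :
    (∀ x y : V, 0 ≤ dF x y) ∧ (∀ x : V, dF x x = 0) ∧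
      ∀ x y : V, ∃ p : G.Walk x y,
        IsGreatest {r : ℝ | ∃ u ∈ p.support, r = dF x u} (dF x y) := by
  classical
  have nonneg (x y : V) : 0 ≤ dF x y := by
    obtain ⟨p, ⟨u, -, hu⟩, -⟩ := (hdF x y).1
    exact hu ▸ dist_nonneg
  refine ⟨nonneg, fun x => le_antisymm ((hdF x x).2 ⟨.nil, ?_⟩) (nonneg x x), fun x y => ?_⟩
  · simp [IsGreatest, upperBounds]
  · obtain ⟨p, -, hp⟩ := (hdF x y).1
    refine ⟨p, ⟨y, p.end_mem_support, rfl⟩, ?_⟩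
    rintro _ ⟨u, hu, rfl⟩
    obtain ⟨r, hr⟩ := (p.takeUntil u hu).exists_isGreatest_support fun v => dist (F x) (F v)
    obtain ⟨v, hv, hrv⟩ := hr.1
    exact ((hdF x u).2 ⟨_, hr⟩).trans (hp ⟨v, p.support_takeUntil_subset_support hu hv, hrv⟩)
end
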